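/- arXiv:1609.01222 — 2 statements merged into one kernel-verified Lean document; each statement's English description precedes it below -/
import Mathlib

section
/- Let E ⊂ T² be a finite set, σ : E → T² an injective map, f ∈ Homeo_{0,λ}(T²), and ε > 0. If d(f(x), σ(x)) < ε for all x ∈ E, then there exists g ∈ Homeo_{0,λ}(T²) such that g(x) = σ(x) for all x ∈ E and d_{C⁰}(f, g) < ε. -/
noncomputable section

open Metric Set Filter Topology MeasureTheory Pointwise

/-- The plane `ℝ²` with the Euclidean metric. -/
abbrev R2 : Type := EuclideanSpace ℝ (Fin 2)

/-- The integer lattice `ℤ² ⊂ ℝ²`. -/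
def intLattice : AddSubgroup R2 where
  carrier := {v : R2 | ∀ i, ∃ n : ℤ, v i = (n : ℝ)}
  add_mem' := by
    intro a b ha hb i
    obtain ⟨m, hm⟩ := ha i
    obtain ⟨n, hn⟩ := hb i
    exact ⟨m + n, by push_cast; rw [← hm, ← hn]; rfl⟩
  zero_mem' := fun i => ⟨0, by simp⟩
  neg_mem' := by
    intro a ha i
    obtain ⟨m, hm⟩ := ha i
    exact ⟨-m, by push_cast; rw [← hm]; rfl⟩

/-- The torus `T² = ℝ²/ℤ²`, with the quotient (Euclidean) metric. -/
abbrev T2 : Type := R2 ⧸ intLattice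

/-- The covering projection `π : ℝ² → T²`. -/
def pr : R2 → T2 := QuotientAddGroup.mk

instance : MeasurableSpace T2 := borel T2
instance : BorelSpace T2 := ⟨rfl⟩

/-- A fundamental domain `[0,1)²` for the lattice action. -/
def fundDomain : Set R2 := {x : R2 | ∀ i, x i ∈ Set.Ico (0 : ℝ) 1}

/-- Lebesgue (Haar) probability measure on the torus `T²`. -/
def lebT2 : Measure T2 := Measure.map pr (volume.restrict fundDomain)

/-- `F : ℝ² → ℝ²` is a lift of `f : T² → T²` if `π ∘ F = f ∘ π` and
`F (x + w) = F x + w` for every lattice vector `w ∈ ℤ²`. -/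
structure IsLift (f : T2 ≃ₜ T2) (F : R2 ≃ₜ R2) : Prop where
  proj : ∀ x : R2, pr (F x) = f (pr x)
  equivariant : ∀ x : R2, ∀ w ∈ intLattice, F (x + w) = F x + w

/-- `Homeo₀(T²)`: homeomorphisms of the torus isotopic to the identity,
characterized as those admitting a lift commuting with integer translations. -/
def Homeo0 : Set (T2 ≃ₜ T2) := {f | ∃ F : R2 ≃ₜ R2, IsLift f F}

/-- `Homeo_{0,λ}(T²)`: elements of `Homeo₀(T²)` preserving Lebesgue measure. -/
def Homeo0Leb : Set (T2 ≃ₜ T2) :=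
  {f | f ∈ Homeo0 ∧ MeasurePreserving f lebT2 lebT2}

/-- The uniform `C⁰` distance `d_{C⁰}(f,g) = sup_x d(f(x), g(x))` on torus maps. -/
def dC0 (f g : T2 ≃ₜ T2) : ℝ := ⨆ x : T2, dist (f x) (g x)

/-- The uniform distance `sup_{x ∈ ℝ²} ‖F(x) − G(x)‖` between maps of the plane. -/
def supDist (F G : R2 → R2) : ℝ := ⨆ x : R2, dist (F x) (G x)

/-- The rotation set `ρ(F̃)` of a lift: all limits `(F̃^{n_k}(z_k) − z_k)/n_k`. -/
def rotSet (F : R2 ≃ₜ R2) : Set R2 :=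
  {v | ∃ (z : ℕ → R2) (n : ℕ → ℕ), Tendsto n atTop atTop ∧
    Tendsto (fun k => (n k : ℝ)⁻¹ • ((⇑F)^[n k] (z k) - z k)) atTop (𝓝 v)}

/-- The rotation set of `f`, with fixed lift `F`, is `δ`-upper-stable in `H`. -/
def UpperStable (H : Set (T2 ≃ₜ T2)) (F : R2 ≃ₜ R2) (δ : ℝ) : Prop :=
  ∀ g ∈ H, ∀ G : R2 ≃ₜ R2, IsLift g G → supDist (⇑F) (⇑G) < δ →
    rotSet G ⊆ rotSet F

/-- The rotation set of `f`, with fixed lift `F`, is `δ`-stable in `H`. -/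
def StableRS (H : Set (T2 ≃ₜ T2)) (F : R2 ≃ₜ R2) (δ : ℝ) : Prop :=
  ∀ g ∈ H, ∀ G : R2 ≃ₜ R2, IsLift g G → supDist (⇑F) (⇑G) < δ →
    rotSet G = rotSet F

/-- `f` has a stable rotation set in `H`. -/
def HasStableRotSet (H : Set (T2 ≃ₜ T2)) (f : T2 ≃ₜ T2) : Prop :=
  ∃ F : R2 ≃ₜ R2, IsLift f F ∧ ∃ δ > 0, StableRS H F δ

/-- `S` is open in `H` for the uniform `C⁰` topology. -/
def OpenIn (H S : Set (T2 ≃ₜ T2)) : Prop :=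
  ∀ f ∈ S ∩ H, ∃ δ > 0, ∀ g ∈ H, dC0 f g < δ → g ∈ S

/-- `S` is dense in `H` for the uniform `C⁰` topology. -/
def DenseIn (H S : Set (T2 ≃ₜ T2)) : Prop :=
  ∀ f ∈ H, ∀ ε > 0, ∃ g ∈ S ∩ H, dC0 f g < ε

/-- `(x_i)_{0 ≤ i ≤ n}` is a finite `ε`-pseudo-orbit of `F`. -/
def IsPseudoOrbitUpTo (F : R2 → R2) (ε : ℝ) (x : ℕ → R2) (n : ℕ) : Prop :=
  ∀ i < n, dist (F (x i)) (x (i + 1)) < ε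

/-- `(x_i)_{i ∈ ℕ}` is an infinite `ε`-pseudo-orbit of `F`. -/
def IsPseudoOrbit (F : R2 → R2) (ε : ℝ) (x : ℕ → R2) : Prop :=
  ∀ i : ℕ, dist (F (x i)) (x (i + 1)) < ε

/-- The `ε`-pseudo-rotation set `ρ_ε(F̃)`. -/
def pseudoRotSet (F : R2 → R2) (ε : ℝ) : Set R2 :=
  {v | ∃ (n : ℕ → ℕ) (x : ℕ → ℕ → R2), Tendsto n atTop atTop ∧
    (∀ k, IsPseudoOrbitUpTo F ε (x k) (n k)) ∧
    Tendsto (fun k => (n k : ℝ)⁻¹ • (x k (n k) - x k 0)) atTop (𝓝 v)}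

/-- The oscillation `osc(f) = sup_{x,y} ‖(F(x) − x) − (F(y) − y)‖` of a lift. -/
def osc (F : R2 → R2) : ℝ := ⨆ p : R2 × R2, ‖(F p.1 - p.1) - (F p.2 - p.2)‖

/-- `f` has the shadowing property. -/
def Shadowing (f : T2 ≃ₜ T2) : Prop :=
  ∀ ε > 0, ∃ δ > 0, ∀ x : ℕ → T2, (∀ i, dist (f (x i)) (x (i + 1)) < δ) →
    ∃ z : T2, ∀ i, dist ((⇑f)^[i] z) (x i) < ε

/-- `v ∈ ℚ² ⊂ ℝ²`. -/
def IsRationalPoint (v : R2) : Prop := ∀ i, ∃ q : ℚ, v i = (q : ℝ)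



lemma pr_add (a b : R2) : pr (a + b) = pr a + pr b := rfl
lemma pr_sub (a b : R2) : pr (a - b) = pr a - pr b := rfl
lemma pr_neg (a : R2) : pr (- a) = - pr a := rfl
lemma pr_zero : pr 0 = 0 := rfl

lemma pr_eq_iff (a b : R2) : pr a = pr b ↔ b - a ∈ intLattice := by
  unfold pr
  rw [QuotientAddGroup.eq, neg_add_eq_sub]

lemma pr_eq_zero_iff (a : R2) : pr a = 0 ↔ a ∈ intLattice := by
  unfold pr
  rw [QuotientAddGroup.eq_zero_iff]

lemma pr_surj (y : T2) : ∃ x, pr x = y := QuotientAddGroup.mk_surjective y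

lemma pr_cont : Continuous pr := continuous_quot_mk

lemma pr_quot : IsQuotientMap pr := isQuotientMap_quot_mk

lemma norm_pr_le (a : R2) : ‖pr a‖ ≤ ‖a‖ := QuotientAddGroup.norm_mk_le_norm

lemma exists_lift_lt (y : T2) (r : ℝ) (h : ‖y‖ < r) : ∃ x, pr x = y ∧ ‖x‖ < r :=
  QuotientAddGroup.norm_lt_iff.1 h

lemma lattice_closed : IsClosed (intLattice : Set R2) := by
  have : (intLattice : Set R2) = ⋂ i, (fun v : R2 => v i) ⁻¹' (range (Int.cast : ℤ → ℝ)) := by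
    ext v
    simp only [mem_iInter, mem_preimage, mem_range]
    exact forall_congr' fun i => ⟨fun ⟨n, h⟩ => ⟨n, h.symm⟩, fun ⟨n, h⟩ => ⟨n, h.symm⟩⟩
  rw [this]
  refine isClosed_iInter fun i => IsClosed.preimage (by fun_prop) ?_
  exact Int.isClosedEmbedding_coe_real.isClosed_range

lemma T2_norm_pos (y : T2) (h : y ≠ 0) : 0 < ‖y‖ := by
  obtain ⟨x, rfl⟩ := pr_surj y
  have := lattice_closed
  refine lt_of_le_of_ne (norm_nonneg _) fun h0 => h ?_
  rw [pr_eq_zero_iff]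
  exact QuotientAddGroup.norm_mk_eq_zero.1 h0.symm

lemma lattice_countable : Countable intLattice := by
  have : Function.Injective
      (fun w : intLattice => fun i : Fin 2 => (w.2 i).choose) := by
    intro a b hab
    ext i
    rw [(a.2 i).choose_spec, (b.2 i).choose_spec]
    exact_mod_cast congrFun hab i
  exact this.countable

/-- integer part -/
def fl (x : R2) : R2 := !₂[(⌊x 0⌋ : ℝ), (⌊x 1⌋ : ℝ)]

def fr (x : R2) : R2 := x - fl x

lemma fl_mem (x : R2) : fl x ∈ intLattice := by
  intro i
  fin_cases i
  · exact ⟨⌊x 0⌋, rfl⟩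
  · exact ⟨⌊x 1⌋, rfl⟩

lemma fr_mem (x : R2) : fr x ∈ fundDomain := by
  intro i
  fin_cases i
  · exact ⟨Int.fract_nonneg (x 0), Int.fract_lt_one (x 0)⟩
  · exact ⟨Int.fract_nonneg (x 1), Int.fract_lt_one (x 1)⟩

lemma fr_add_fl (x : R2) : fr x + fl x = x := by simp [fr]

lemma fr_eq (x : R2) : fr x = !₂[Int.fract (x 0), Int.fract (x 1)] := by
  ext i
  fin_cases i <;> simp [fr, fl]

lemma fl_add (x w : R2) (hw : w ∈ intLattice) : fl (x + w) = fl x + w := by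
  obtain ⟨a, ha⟩ := hw 0
  obtain ⟨b, hb⟩ := hw 1
  ext i
  fin_cases i <;> simp [fl, ha, hb]

lemma fl_zero (x : R2) (hx : x ∈ fundDomain) : fl x = 0 := by
  ext i
  have := hx i
  fin_cases i
  · simpa [fl, Int.floor_eq_zero_iff] using this
  · simpa [fl, Int.floor_eq_zero_iff] using this

lemma meas_fund : MeasurableSet fundDomain := by
  have : fundDomain = ⋂ i, (fun v : R2 => v i) ⁻¹' (Ico (0:ℝ) 1) := by
    ext v; simp [fundDomain]
  rw [this]
  exact MeasurableSet.iInter fun i => measurableSet_Ico.preimage (by fun_prop)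

lemma isFund (c : R2) : IsAddFundamentalDomain intLattice ((fun x => x + c) ⁻¹' fundDomain) volume := by
  refine IsAddFundamentalDomain.mk' (meas_fund.preimage (by fun_prop)).nullMeasurableSet fun x => ?_
  refine ⟨⟨- fl (x + c), intLattice.neg_mem (fl_mem _)⟩, ?_, ?_⟩
  · have := fr_mem (x + c)
    simp only [mem_preimage, AddSubgroup.mk_vadd, vadd_eq_add]
    convert this using 1
    simp only [fr]; abel
  · rintro ⟨w, hw⟩ h
    simp only [mem_preimage, AddSubgroup.mk_vadd, vadd_eq_add] at h
    have h1 := fl_zero _ h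
    rw [show w + x + c = (x + c) + w by abel, fl_add _ _ hw] at h1
    ext1
    exact (neg_eq_of_add_eq_zero_right h1).symm

lemma leb_translate (c : R2) : MeasurePreserving (fun y : T2 => y + pr c) lebT2 lebT2 := by
  have hpm : Measurable pr := pr_cont.measurable
  have htm : Measurable (fun y : T2 => y + pr c) :=
    (by fun_prop : Continuous (fun y : T2 => y + pr c)).measurable
  refine ⟨htm, ?_⟩
  ext A hA
  have hc := lattice_countable
  rw [Measure.map_apply htm hA, lebT2, Measure.map_apply hpm (htm hA), Measure.map_apply hpm hA,
    Measure.restrict_apply (hpm (htm hA)), Measure.restrict_apply (hpm hA)]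
  have h1 : volume ((fun x : R2 => x + c) ⁻¹' (pr ⁻¹' A ∩ (fun x => x + (-c)) ⁻¹' fundDomain))
      = volume (pr ⁻¹' A ∩ (fun x => x + (-c)) ⁻¹' fundDomain) :=
    measure_preimage_add_right _ _ _
  have h2 : (fun x : R2 => x + c) ⁻¹' (pr ⁻¹' A ∩ (fun x => x + (-c)) ⁻¹' fundDomain)
      = pr ⁻¹' ((fun y : T2 => y + pr c) ⁻¹' A) ∩ fundDomain := by
    ext x
    simp [pr_add]
  rw [← h2, h1]
  have h3 := isFund 0
  simp only [add_zero, preimage_id'] at h3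
  refine (isFund (-c)).measure_set_eq h3 (hpm hA) ?_
  rintro ⟨w, hw⟩
  ext x
  have : pr (w + x) = pr x := by
    rw [pr_add, (pr_eq_zero_iff w).2 hw, zero_add]
  simp [this]

lemma exists_of_lift (F : R2 ≃ₜ R2) (hF : ∀ x : R2, ∀ w ∈ intLattice, F (x + w) = F x + w) :
    ∃ f : T2 ≃ₜ T2, IsLift f F := by
  have hG : ∀ x : R2, ∀ w ∈ intLattice, F.symm (x + w) = F.symm x + w := by
    intro x w hw
    apply F.injective
    rw [hF _ _ hw]; simp
  have key : ∀ F : R2 → R2, (∀ x : R2, ∀ w ∈ intLattice, F (x + w) = F x + w) → Continuous F →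
      ∃ f : T2 → T2, Continuous f ∧ ∀ x, f (pr x) = pr (F x) := by
    intro F hF hc
    have hw : ∀ a b : R2, (QuotientAddGroup.leftRel intLattice) a b → pr (F a) = pr (F b) := by
      intro a b hab
      rw [QuotientAddGroup.leftRel_apply] at hab
      have := hF a _ hab
      rw [add_neg_cancel_left] at this
      rw [this, pr_add, (pr_eq_zero_iff _).2 hab, add_zero]
    exact ⟨Quotient.lift (pr ∘ F) hw, (pr_cont.comp hc).quotient_lift hw, fun x => rfl⟩
  obtain ⟨f, hfc, hf⟩ := key F hF F.continuous
  obtain ⟨g, hgc, hg⟩ := key F.symm hG F.symm.continuous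
  refine ⟨⟨⟨f, g, ?_, ?_⟩, hfc, hgc⟩, ⟨fun x => (hf x).symm, hF⟩⟩
  · intro y
    obtain ⟨x, rfl⟩ := pr_surj y
    rw [hf, hg]; simp
  · intro y
    obtain ⟨x, rfl⟩ := pr_surj y
    rw [hg, hf]; simp

lemma Homeo0Leb_trans {f g : T2 ≃ₜ T2} (hf : f ∈ Homeo0Leb) (hg : g ∈ Homeo0Leb) :
    f.trans g ∈ Homeo0Leb := by
  obtain ⟨⟨F, hF⟩, hf2⟩ := hf
  obtain ⟨⟨G, hG⟩, hg2⟩ := hg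
  refine ⟨⟨F.trans G, ⟨fun x => ?_, fun x w hw => ?_⟩⟩, hg2.comp hf2⟩
  · simp [hG.proj, hF.proj]
  · simp [hF.equivariant _ _ hw, hG.equivariant _ _ hw]

lemma Homeo0Leb_symm {f : T2 ≃ₜ T2} (hf : f ∈ Homeo0Leb) : f.symm ∈ Homeo0Leb := by
  obtain ⟨⟨F, hF⟩, hf2⟩ := hf
  refine ⟨⟨F.symm, ⟨fun x => ?_, fun x w hw => ?_⟩⟩, hf2.symm f.toMeasurableEquiv⟩
  · apply f.injective
    rw [← hF.proj]; simp
  · apply F.injective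
    rw [hF.equivariant _ _ hw]; simp

lemma Homeo0Leb_refl : Homeomorph.refl T2 ∈ Homeo0Leb :=
  ⟨⟨Homeomorph.refl R2, ⟨fun x => rfl, fun x w hw => rfl⟩⟩, MeasurePreserving.id _⟩

lemma Homeo0Leb_translate (c : R2) : Homeomorph.addRight (pr c) ∈ Homeo0Leb :=
  ⟨⟨Homeomorph.addRight c, ⟨fun x => rfl, fun x w hw => by simp [add_right_comm]⟩⟩, leb_translate c⟩

/-- twist map -/
def tw (θ : ℝ → ℝ) (z : ℂ) : ℂ := z * Complex.exp ((θ ‖z‖ : ℝ) * Complex.I)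

lemma tw_norm (θ : ℝ → ℝ) (z : ℂ) : ‖tw θ z‖ = ‖z‖ := by
  simp [tw, Complex.norm_exp_ofReal_mul_I]

lemma tw_tw (θ φ : ℝ → ℝ) (h : ∀ r, φ r = - θ r) (z : ℂ) : tw φ (tw θ z) = z := by
  rw [tw, tw_norm, h, tw, mul_assoc, ← Complex.exp_add]
  simp

lemma tw_cont (θ : ℝ → ℝ) (h : Continuous θ) : Continuous (tw θ) := by
  unfold tw; fun_prop

def twH (θ : ℝ → ℝ) (h : Continuous θ) : ℂ ≃ₜ ℂ where
  toFun := tw θ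
  invFun := tw (fun r => - θ r)
  left_inv := tw_tw _ _ (fun _ => rfl)
  right_inv := tw_tw _ _ (fun r => (neg_neg _).symm)
  continuous_toFun := tw_cont θ h
  continuous_invFun := tw_cont _ h.neg

lemma lint_shift (f : ℂ → ENNReal) (r a : ℝ) :
    ∫⁻ t in Ioo (-Real.pi) Real.pi, f (r * Complex.exp ((t + a : ℝ) * Complex.I)) =
    ∫⁻ t in Ioo (-Real.pi) Real.pi, f (r * Complex.exp ((t : ℝ) * Complex.I)) := by
  have hT : Fact (0 < 2 * Real.pi) := ⟨Real.two_pi_pos⟩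
  let g : AddCircle (2 * Real.pi) → ENNReal := fun b => f (r * (AddCircle.toCircle b : ℂ))
  have hg : ∀ t : ℝ, g (t : AddCircle (2 * Real.pi)) = f (r * Complex.exp ((t : ℝ) * Complex.I)) := by
    intro t
    simp only [g, AddCircle.toCircle_apply_mk, Circle.coe_exp]
    congr 5
    field_simp
  have e : -Real.pi + 2 * Real.pi = Real.pi := by ring
  have h1 := AddCircle.lintegral_preimage (2 * Real.pi) (-Real.pi) g
  have h2 := AddCircle.lintegral_preimage (2 * Real.pi) (-Real.pi) (fun b => g (b + (a : AddCircle (2 * Real.pi))))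
  rw [lintegral_add_right_eq_self, ← h1, e] at h2
  simp only [← AddCircle.coe_add, hg] at h2
  rw [restrict_Ioo_eq_restrict_Ioc]
  exact h2

lemma lint_polar (f : ℂ → ENNReal) (hf : Measurable f) : ∫⁻ z, f z =
    ∫⁻ r in Ioi (0:ℝ), ∫⁻ t in Ioo (-Real.pi) Real.pi,
      ENNReal.ofReal r * f (r * Complex.exp ((t : ℝ) * Complex.I)) := by
  rw [← Complex.lintegral_comp_polarCoord_symm, polarCoord_target, Measure.volume_eq_prod,
    ← Measure.prod_restrict, lintegral_prod]
  · simp only [Complex.polarCoord_symm_apply, smul_eq_mul, Complex.exp_mul_I, Complex.ofReal_cos,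
      Complex.ofReal_sin]
  · refine Measurable.aemeasurable ?_
    simp only [Complex.polarCoord_symm_apply, smul_eq_mul]
    refine Measurable.mul (by fun_prop) (hf.comp ?_)
    fun_prop

lemma tw_mp (θ : ℝ → ℝ) (h : Continuous θ) : MeasurePreserving (tw θ) volume volume := by
  have hm := (tw_cont θ h).measurable
  refine ⟨hm, ?_⟩
  ext A hA
  rw [Measure.map_apply hm hA, ← lintegral_indicator_one hA, ← lintegral_indicator_one (hm hA),
    lint_polar _ (measurable_one.indicator hA), lint_polar _ (measurable_one.indicator (hm hA))]
  refine setLIntegral_congr_fun measurableSet_Ioi fun r hr => ?_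
  rw [lintegral_const_mul', lintegral_const_mul', ← lint_shift (A.indicator 1) r (θ r)]
  · congr 2
    ext t
    have : tw θ (r * Complex.exp ((t : ℝ) * Complex.I)) = r * Complex.exp ((t + θ r : ℝ) * Complex.I) := by
      have hn : ‖(r * Complex.exp ((t : ℝ) * Complex.I) : ℂ)‖ = r := by
        simp [Complex.norm_exp_ofReal_mul_I, abs_of_pos (mem_Ioi.1 hr)]
      rw [tw, hn, mul_assoc, ← Complex.exp_add]
      push_cast
      ring_nf
    change A.indicator 1 (tw θ (r * Complex.exp ((t : ℝ) * Complex.I))) = _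
    rw [this]
  · exact ENNReal.ofReal_ne_top
  · exact ENNReal.ofReal_ne_top

lemma exists_twist (ρ R : ℝ) (hR : ρ < R) : ∃ T : R2 ≃ₜ R2, MeasurePreserving T volume volume ∧
    (∀ x, ‖T x‖ = ‖x‖) ∧ (∀ x, R ≤ ‖x‖ → T x = x) ∧ (∀ x, ‖x‖ ≤ ρ → T x = -x) := by
  let θ : ℝ → ℝ := fun r => Real.pi * max 0 (min 1 ((R - r) / (R - ρ)))
  have hθ : Continuous θ := by
    simp only [θ]; fun_prop
  let e : ℂ ≃ₗᵢ[ℝ] R2 := Complex.orthonormalBasisOneI.repr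
  have hρ : 0 < R - ρ := by linarith
  refine ⟨(e.symm.toHomeomorph.trans (twH θ hθ)).trans e.toHomeomorph, ?_, ?_, ?_, ?_⟩
  · exact e.measurePreserving.comp ((tw_mp θ hθ).comp e.symm.measurePreserving)
  · intro x
    change ‖e (tw θ (e.symm x))‖ = ‖x‖
    rw [e.norm_map, tw_norm, e.symm.norm_map]
  · intro x hx
    change e (tw θ (e.symm x)) = x
    have h0 : θ ‖x‖ = 0 := by
      have : (R - ‖x‖) / (R - ρ) ≤ 0 := div_nonpos_of_nonpos_of_nonneg (by linarith) hρ.le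
      simp only [θ]
      rw [max_eq_left, mul_zero]
      exact (min_le_right _ _).trans this
    rw [tw, e.symm.norm_map, h0]; simp
  · intro x hx
    change e (tw θ (e.symm x)) = -x
    have h0 : θ ‖x‖ = Real.pi := by
      have : 1 ≤ (R - ‖x‖) / (R - ρ) := by
        rw [le_div_iff₀ hρ]; linarith
      simp only [θ]
      rw [min_eq_left this]; simp
    rw [tw, e.symm.norm_map, h0]; simp

lemma cont_per (u : R2 → R2) (hu : Continuous u)
    (h0 : ∀ x : R2, (∃ i, x i = 0 ∨ x i = 1) → u x = 0) : Continuous (fun x => u (fr x)) := by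
  have h1 : Continuous fun p : ℝ × ℝ => u !₂[p.1, Int.fract p.2] := by
    refine ContinuousOn.comp_fract (s := fun p : ℝ × ℝ => p.2)
      (f := fun p t => u !₂[p.1, t]) ?_ continuous_snd ?_
    · apply Continuous.continuousOn
      unfold Function.uncurry
      fun_prop
    · intro s
      rw [h0 _ ⟨1, Or.inl (by simp)⟩, h0 _ ⟨1, Or.inr (by simp)⟩]
  have h2 : Continuous fun p : ℝ × ℝ => u !₂[Int.fract p.1, Int.fract p.2] := by
    refine ContinuousOn.comp_fract (s := fun p : ℝ × ℝ => p.1)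
      (f := fun p t => u !₂[t, Int.fract p.2]) ?_ continuous_fst ?_
    · apply Continuous.continuousOn
      exact h1.comp (f := fun q : (ℝ × ℝ) × ℝ => (q.2, q.1.2)) (by fun_prop)
    · intro s
      rw [h0 _ ⟨0, Or.inl (by simp)⟩, h0 _ ⟨0, Or.inr (by simp)⟩]
  have h3 : Continuous fun x : R2 => (x 0, x 1) := by fun_prop
  simp only [fr_eq]
  exact h2.comp h3

/-- the centre of the square -/
def ctr : R2 := !₂[1/2, 1/2]

lemma coord_le (x : R2) (i : Fin 2) : |x i| ≤ ‖x‖ := by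
  simpa using PiLp.norm_apply_le x i

lemma far_of_notMem (x : R2) (hx : x ∉ fundDomain) : 1/2 ≤ ‖x - ctr‖ := by
  by_contra h
  push Not at h
  refine hx fun i => ?_
  have h1 := (coord_le (x - ctr) i).trans_lt h
  rw [abs_lt] at h1
  have h2 : (x - ctr) i = x i - 1/2 := by fin_cases i <;> simp [ctr]
  rw [h2] at h1
  exact ⟨by linarith, by linarith⟩

lemma far_of_bdry (x : R2) (hx : ∃ i, x i = 0 ∨ x i = 1) : 1/2 ≤ ‖x - ctr‖ := by
  obtain ⟨i, hi⟩ := hx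
  refine le_trans ?_ (coord_le (x - ctr) i)
  have h2 : (x - ctr) i = x i - 1/2 := by fin_cases i <;> simp [ctr]
  rw [h2, le_abs]
  rcases hi with hi | hi <;> rw [hi] <;> norm_num

lemma periodize (T : R2 ≃ₜ R2) (hT : MeasurePreserving T volume volume)
    (hn : ∀ x, 1/2 ≤ ‖x - ctr‖ → T x = x) :
    ∃ f ∈ Homeo0Leb, ∀ x ∈ fundDomain, f (pr x) = pr (T x) := by
  have hs : ∀ x, 1/2 ≤ ‖x - ctr‖ → T.symm x = x := by
    intro x hx
    rw [Homeomorph.symm_apply_eq, hn x hx]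
  have hmap : ∀ T : R2 ≃ₜ R2, (∀ x, 1/2 ≤ ‖x - ctr‖ → T x = x) → ∀ x ∈ fundDomain, T x ∈ fundDomain := by
    intro T hn x hx
    by_contra h
    have h1 := hn _ (far_of_notMem _ h)
    have h2 := T.injective h1
    rw [h2] at h
    exact h hx
  let P : (R2 ≃ₜ R2) → R2 → R2 := fun T x => T (fr x) + fl x
  have hPc : ∀ T : R2 ≃ₜ R2, (∀ x, 1/2 ≤ ‖x - ctr‖ → T x = x) → Continuous (P T) := by
    intro T hn
    have := cont_per (fun x => T x - x) (by fun_prop) (fun x hx => by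
      rw [hn x (far_of_bdry x hx), sub_self])
    have h2 : Continuous fun x => T (fr x) - fr x + x := this.add continuous_id
    convert h2 using 1
    ext1 x
    have := fr_add_fl x
    calc T (fr x) + fl x = T (fr x) - fr x + (fr x + fl x) := by abel
      _ = _ := by rw [this]
  have hfl : ∀ x w, x ∈ fundDomain → w ∈ intLattice → fl (x + w) = w := by
    intro x w hx hw
    rw [fl_add _ _ hw, fl_zero _ hx, zero_add]
  have hPP : ∀ T S : R2 ≃ₜ R2, (∀ x, 1/2 ≤ ‖x - ctr‖ → T x = x) → (∀ x, S (T x) = x) →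
      ∀ x, P S (P T x) = x := by
    intro T S hT hS x
    simp only [P]
    rw [fr, hfl _ _ (hmap T hT _ (fr_mem x)) (fl_mem x), add_sub_cancel_right, hS, fr_add_fl]
  let F : R2 ≃ₜ R2 := 
    { toFun := P T
      invFun := P T.symm
      left_inv := hPP T T.symm hn (by simp)
      right_inv := hPP T.symm T hs (by simp)
      continuous_toFun := hPc T hn
      continuous_invFun := hPc _ hs }
  have hF : ∀ x : R2, ∀ w ∈ intLattice, F (x + w) = F x + w := by
    intro x w hw
    change T (fr (x + w)) + fl (x + w) = T (fr x) + fl x + w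
    rw [fr, fl_add _ _ hw, fr, add_sub_add_right_eq_sub, add_assoc]
  obtain ⟨f, hf⟩ := exists_of_lift F hF
  have hfx : ∀ x ∈ fundDomain, f (pr x) = pr (T x) := by
    intro x hx
    rw [← hf.proj]
    change pr (T (fr x) + fl x) = _
    rw [fr, fl_zero x hx, sub_zero, add_zero]
  refine ⟨f, ⟨⟨F, hf⟩, ?_⟩, hfx⟩
  have hpm : Measurable pr := pr_cont.measurable
  have hfm : Measurable f := f.continuous.measurable
  refine ⟨hfm, ?_⟩
  ext A hA
  rw [Measure.map_apply hfm hA, lebT2, Measure.map_apply hpm (hfm hA), Measure.map_apply hpm hA,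
    Measure.restrict_apply (hpm (hfm hA)), Measure.restrict_apply (hpm hA),
    ← hT.measure_preimage ((hpm hA).inter meas_fund).nullMeasurableSet]
  congr 1
  ext x
  simp only [mem_inter_iff, mem_preimage]
  constructor
  · rintro ⟨h1, h2⟩
    rw [hfx x h2] at h1
    exact ⟨h1, hmap T hn x h2⟩
  · rintro ⟨h1, h2⟩
    have h3 : x ∈ fundDomain := by
      have := hmap T.symm hs _ h2
      simpa using this
    rw [hfx x h3]
    exact ⟨h1, h3⟩

lemma swap0 (c : T2) (x : R2) (R : ℝ) (hx : ‖x‖ < R) (hR : R < 1/2) :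
    ∃ g ∈ Homeo0Leb, g (c + pr x) = c - pr x ∧
      ∀ y, g y = y ∨ (dist y c < R ∧ dist (g y) c < R) := by
  obtain ⟨T0, h1, h2, h3, h4⟩ := exists_twist ‖x‖ R hx
  let T : R2 ≃ₜ R2 := ((Homeomorph.addRight (-ctr)).trans T0).trans (Homeomorph.addRight ctr)
  have hTa : ∀ z, T z = T0 (z - ctr) + ctr := fun z => by simp [T, sub_eq_add_neg]
  have hT : MeasurePreserving T volume volume :=
    (measurePreserving_add_right volume ctr).comp (h1.comp (measurePreserving_add_right volume (-ctr)))
  have hn : ∀ z, 1/2 ≤ ‖z - ctr‖ → T z = z := by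
    intro z hz
    rw [hTa, h3 _ (by linarith)]; simp
  obtain ⟨f, hf, hfx⟩ := periodize T hT hn
  obtain ⟨c, rfl⟩ := pr_surj c
  have key : ∀ z, ‖z‖ < 1/2 → f (pr (z + ctr)) = pr (T0 z + ctr) := by
    intro z hz
    rw [hfx, hTa, add_sub_cancel_right]
    by_contra h
    have := far_of_notMem _ h
    rw [add_sub_cancel_right] at this
    linarith
  refine ⟨((Homeomorph.addRight (pr (ctr - c))).trans f).trans (Homeomorph.addRight (pr (c - ctr))),
    Homeo0Leb_trans (Homeo0Leb_trans (Homeo0Leb_translate _) hf) (Homeo0Leb_translate _), ?_, ?_⟩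
  · change f (pr c + pr x + pr (ctr - c)) + pr (c - ctr) = _
    rw [show pr c + pr x + pr (ctr - c) = pr (x + ctr) by rw [← pr_add, ← pr_add]; congr 1; abel,
      key _ (by linarith), h4 _ le_rfl, ← pr_add, ← pr_sub]
    congr 1; abel
  · intro y
    obtain ⟨y, rfl⟩ := pr_surj y
    change f (pr y + pr (ctr - c)) + pr (c - ctr) = _ ∨ _ ∧ dist (f (pr y + pr (ctr - c)) + pr (c - ctr)) _ < _
    set z := fr (y + (ctr - c)) with hz
    have hzy : pr y + pr (ctr - c) = pr z := by
      rw [hz, fr, pr_sub _ (fl _), (pr_eq_zero_iff _).2 (fl_mem _), sub_zero, pr_add]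
    have hyz : pr y = pr (z - ctr + c) := by
      rw [show pr y = pr z - pr (ctr - c) by rw [← hzy]; abel, ← pr_sub]
      congr 1; abel
    rw [hzy, hfx z (fr_mem _), hTa, ← pr_add, hyz, dist_eq_norm, dist_eq_norm, ← pr_sub, ← pr_sub]
    by_cases hlt : ‖z - ctr‖ < R
    · right
      rw [add_sub_cancel_right]
      refine ⟨(norm_pr_le _).trans_lt hlt, (norm_pr_le _).trans_lt ?_⟩
      rw [show T0 (z - ctr) + ctr + (c - ctr) - c = T0 (z - ctr) by abel, h2]
      exact hlt
    · left
      push Not at hlt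
      rw [h3 _ hlt]
      congr 1; abel

lemma step_aux (p : T2 → T2) (v : T2 → R2) (E : Set T2) (R : ℝ) (hR : R < 1/2)
    (hv : ∀ i ∈ E, ‖v i‖ < 2 * R)
    (hd : ∀ i ∈ E, ∀ j ∈ E, i ≠ j → 4 * R ≤ dist (p i) (p j)) (A : Set T2) (hA : A.Finite) (hAE : A ⊆ E) :
    ∃ g ∈ Homeo0Leb, (∀ i ∈ A, g (p i) = p i + pr (v i)) ∧
      ∀ y, g y = y ∨ ∃ i ∈ A, dist y (p i + pr ((1/2 : ℝ) • v i)) < R ∧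
        dist (g y) (p i + pr ((1/2 : ℝ) • v i)) < R := by
  have hhalf : ∀ i ∈ E, ‖(1/2 : ℝ) • v i‖ < R := by
    intro i hi
    have := hv i hi
    rw [norm_smul]; norm_num; linarith
  have hpc : ∀ i ∈ E, dist (p i) (p i + pr ((1/2 : ℝ) • v i)) < R := by
    intro i hi
    rw [dist_self_add_right]
    exact (norm_pr_le _).trans_lt (hhalf i hi)
  have hsum : ∀ i, p i + pr (v i) = p i + pr ((1/2 : ℝ) • v i) + pr ((1/2 : ℝ) • v i) := by
    intro i
    rw [add_assoc, ← pr_add, ← add_smul]; norm_num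
  have hqc : ∀ i ∈ E, dist (p i + pr (v i)) (p i + pr ((1/2 : ℝ) • v i)) < R := by
    intro i hi
    rw [hsum i, dist_self_add_left]
    exact (norm_pr_le _).trans_lt (hhalf i hi)
  have hdisj : ∀ i ∈ E, ∀ j ∈ E, i ≠ j → ∀ y, dist y (p i + pr ((1/2 : ℝ) • v i)) < R →
      dist y (p j + pr ((1/2 : ℝ) • v j)) < R → False := by
    intro i hi j hj hij y h1 h2
    have h3 := hd i hi j hj hij
    have h4 := dist_triangle4 (p i) (p i + pr ((1/2 : ℝ) • v i)) (p j + pr ((1/2 : ℝ) • v j)) (p j)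
    have h5 := dist_triangle_left (p i + pr ((1/2 : ℝ) • v i)) (p j + pr ((1/2 : ℝ) • v j)) y
    have h6 := hpc i hi
    have h7 := hpc j hj
    rw [dist_comm] at h7
    linarith
  induction A, hA using Set.Finite.induction_on with
  | empty => exact ⟨_, Homeo0Leb_refl, by simp, fun y => Or.inl rfl⟩
  | @insert a A haA hA ih =>
    obtain ⟨g, hg, hg1, hg2⟩ := ih ((subset_insert _ _).trans hAE)
    have haE : a ∈ E := hAE (mem_insert _ _)
    have hAE' : ∀ i ∈ A, i ∈ E := fun i hi => hAE (mem_insert_of_mem _ hi)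
    have hne : ∀ i ∈ A, i ≠ a := fun i hi h => haA (h ▸ hi)
    obtain ⟨k, hk, hk1, hk2⟩ := swap0 (p a + pr ((1/2 : ℝ) • v a)) (-((1/2 : ℝ) • v a)) R
      (by rw [norm_neg]; exact hhalf a haE) hR
    rw [pr_neg, add_neg_cancel_right, sub_neg_eq_add, ← hsum] at hk1
    have hkfix : ∀ i ∈ A, ∀ y, dist y (p i + pr ((1/2 : ℝ) • v i)) < R → k y = y := by
      intro i hi y hy
      rcases hk2 y with h | h
      · exact h
      · exact (hdisj i (hAE' i hi) a haE (hne i hi) y hy h.1).elim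
    refine ⟨g.trans k, Homeo0Leb_trans hg hk, ?_, ?_⟩
    · intro i hi
      rw [Homeomorph.trans_apply]
      rcases hi with rfl | hi
      · rcases hg2 (p i) with h | ⟨j, hj, h, -⟩
        · rw [h, hk1]
        · exact (hdisj j (hAE' j hj) i haE (hne j hj) _ h (hpc i haE)).elim
      · rw [hg1 i hi]
        exact hkfix i hi _ (hqc i (hAE' i hi))
    · intro y
      rw [Homeomorph.trans_apply]
      rcases hg2 y with h | ⟨j, hj, h, h'⟩
      · rw [h]
        rcases hk2 y with h | h
        · exact Or.inl h
        · exact Or.inr ⟨a, mem_insert _ _, h⟩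
      · right
        rw [hkfix j hj _ h']
        exact ⟨j, mem_insert_of_mem _ hj, h, h'⟩

lemma step (p : T2 → T2) (v : T2 → R2) (E : Set T2) (hE : E.Finite) (R : ℝ) (h0 : 0 < R) (hR : R < 1/2)
    (hv : ∀ i ∈ E, ‖v i‖ < 2 * R)
    (hd : ∀ i ∈ E, ∀ j ∈ E, i ≠ j → 4 * R ≤ dist (p i) (p j)) :
    ∃ g ∈ Homeo0Leb, (∀ i ∈ E, g (p i) = p i + pr (v i)) ∧ ∀ y, dist (g y) y ≤ 2 * R := by
  obtain ⟨g, hg, h1, h2⟩ := step_aux p v E R hR hv hd E hE subset_rfl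
  refine ⟨g, hg, h1, fun y => ?_⟩
  rcases h2 y with h | ⟨i, -, h, h'⟩
  · rw [h, dist_self]; linarith
  · have := dist_triangle_right (g y) y (p i + pr ((1/2 : ℝ) • v i))
    linarith

lemma path (p : T2 → T2) (v : T2 → R2) (E : Set T2) (hE : E.Finite) (a : ℝ) (ha : 0 < a)
    (hv : ∀ i ∈ E, ‖v i‖ < a)
    (hd : ∀ i ∈ E, ∀ j ∈ E, i ≠ j → ∀ t ∈ Icc (0:ℝ) 1, p i + pr (t • v i) ≠ p j + pr (t • v j)) :
    ∃ g ∈ Homeo0Leb, (∀ i ∈ E, g (p i) = p i + pr (v i)) ∧ ∀ y, dist (g y) y ≤ a := by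
  have hm : ∀ᶠ m in 𝓝[>] (0:ℝ), ∀ i ∈ E, ∀ j ∈ E, i ≠ j → ∀ t ∈ Icc (0:ℝ) 1,
      m ≤ dist (p i + pr (t • v i)) (p j + pr (t • v j)) := by
    rw [hE.eventually_all]
    intro i hi
    rw [hE.eventually_all]
    intro j hj
    by_cases hij : i = j
    · exact Eventually.of_forall fun m h => (h hij).elim
    have hpc := pr_cont
    have hc : Continuous fun t : ℝ => dist (p i + pr (t • v i)) (p j + pr (t • v j)) := by fun_prop
    obtain ⟨t0, ht0, hmin⟩ := isCompact_Icc.exists_isMinOn (nonempty_Icc.2 zero_le_one) hc.continuousOn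
    have hpos : 0 < dist (p i + pr (t0 • v i)) (p j + pr (t0 • v j)) := by
      rw [dist_eq_norm]
      exact T2_norm_pos _ (sub_ne_zero.2 (hd i hi j hj hij t0 ht0))
    filter_upwards [Ioo_mem_nhdsGT hpos] with m hm _ t ht
    exact hm.2.le.trans (hmin ht)
  obtain ⟨m, hm, hm0⟩ := (hm.and self_mem_nhdsWithin).exists
  obtain ⟨N, hN⟩ := exists_nat_gt (max (2 * a / m) a)
  have hm0 : 0 < m := hm0
  have hN1 : 2 * a / m < N := (le_max_left _ _).trans_lt hN
  have hN2 : a < N := (le_max_right _ _).trans_lt hN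
  have hN0 : (0:ℝ) < N := ha.trans hN2
  have key : ∀ k : ℕ, k ≤ N → ∃ g ∈ Homeo0Leb,
      (∀ i ∈ E, g (p i) = p i + pr (((k:ℝ) / N) • v i)) ∧ ∀ y, dist (g y) y ≤ k * (a / N) := by
    intro k
    induction k with
    | zero =>
      intro _
      exact ⟨_, Homeo0Leb_refl, by simp [pr_zero], by simp⟩
    | succ k ih =>
      intro hk
      obtain ⟨g, hg, hg1, hg2⟩ := ih (by omega)
      have hk01 : (k:ℝ) / N ∈ Icc (0:ℝ) 1 := by
        refine ⟨by positivity, ?_⟩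
        rw [div_le_one hN0]
        exact_mod_cast (by omega : k ≤ N)
      obtain ⟨s, hs, hs1, hs2⟩ := step (fun i => p i + pr (((k:ℝ) / N) • v i))
        (fun i => (1 / (N:ℝ)) • v i) E hE (a / N / 2) (by positivity)
        (by rw [div_lt_div_iff_of_pos_right (by norm_num), div_lt_one hN0]; exact hN2)
        (by
          intro i hi
          have := hv i hi
          rw [norm_smul, Real.norm_of_nonneg (by positivity), mul_div_cancel₀ _ (by norm_num),
            one_div, inv_mul_eq_div]
          gcongr)
        (by
          intro i hi j hj hij
          refine le_trans ?_ (hm i hi j hj hij _ hk01)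
          rw [div_lt_iff₀ hm0] at hN1
          rw [show 4 * (a / N / 2) = 2 * a / N by ring, div_le_iff₀ hN0]
          linarith)
      refine ⟨g.trans s, Homeo0Leb_trans hg hs, ?_, ?_⟩
      · intro i hi
        rw [Homeomorph.trans_apply, hg1 i hi, hs1 i hi, add_assoc, ← pr_add, ← add_smul]
        push_cast
        rw [add_div]
      · intro y
        rw [Homeomorph.trans_apply]
        have h1 := dist_triangle (s (g y)) (g y) y
        have h2 := hs2 (g y)
        have h3 := hg2 y
        push_cast
        linarith
  obtain ⟨g, hg, h1, h2⟩ := key N le_rfl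
  refine ⟨g, hg, ?_, ?_⟩
  · intro i hi
    rw [h1 i hi, div_self hN0.ne', one_smul]
  · intro y
    have := h2 y
    rwa [mul_div_cancel₀ _ hN0.ne'] at this

/-- bad set of perturbations -/
def bad (P : T2) (u : R2) : Set R2 := {w | ∃ t : ℝ, P + pr (t • (u + w)) = 0}

lemma bad_null (P : T2) (u : R2) (hP : P ≠ 0) : volume (bad P u) = 0 := by
  obtain ⟨P, rfl⟩ := pr_surj P
  have hc := lattice_countable
  have hsub : bad (pr P) u ⊆ ⋃ w : intLattice,
      (fun x => u + x) ⁻¹' ((Submodule.span ℝ {(w : R2) - P} : Submodule ℝ R2) : Set R2) := by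
    rintro x ⟨t, ht⟩
    rw [← pr_add, pr_eq_zero_iff] at ht
    refine mem_iUnion.2 ⟨⟨_, ht⟩, ?_⟩
    simp only [mem_preimage, add_sub_cancel_left, SetLike.mem_coe]
    have ht0 : t ≠ 0 := by
      rintro rfl
      rw [zero_smul, add_zero] at ht
      exact hP ((pr_eq_zero_iff _).2 ht)
    rw [Submodule.mem_span_singleton]
    exact ⟨t⁻¹, by rw [smul_smul, inv_mul_cancel₀ ht0, one_smul]⟩
  refine measure_mono_null hsub (measure_iUnion_null fun w => ?_)
  rw [measure_preimage_add]
  refine Measure.addHaar_submodule _ _ fun htop => ?_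
  have h1 := finrank_span_le_card (R := ℝ) ({(w : R2) - P} : Set R2)
  rw [htop, finrank_top] at h1
  simp at h1

lemma generic (p q : T2 → T2) (u v : T2 → R2) (E : Set T2) (hE : E.Finite) (η : ℝ) (hη : 0 < η)
    (hp : InjOn p E) (hq : InjOn q E) : ∃ w : T2 → R2, (∀ i, ‖w i‖ < η) ∧
      ∀ i ∈ E, ∀ j ∈ E, i ≠ j → w i - w j ∉ bad (p i - p j) (u i - u j) ∧
        w i - w j ∉ bad (q i - q j) (v i - v j) := by
  have hsymm : ∀ (P : T2) (U W : R2), -W ∉ bad P U → W ∉ bad (-P) (-U) := by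
    rintro P U W h ⟨t, ht⟩
    refine h ⟨t, ?_⟩
    have h1 := congrArg Neg.neg ht
    rw [neg_zero, neg_add, neg_neg, ← pr_neg, ← smul_neg, neg_add, neg_neg] at h1
    exact h1
  induction E, hE using Set.Finite.induction_on with
  | empty => exact ⟨fun _ => 0, by simpa using hη, by simp⟩
  | @insert a A haA hA ih =>
    obtain ⟨w, hw1, hw2⟩ := ih (hp.mono (subset_insert _ _)) (hq.mono (subset_insert _ _))
    let B : Set R2 := ⋃ j ∈ A, ((fun x => x + (-w j)) ⁻¹' bad (p a - p j) (u a - u j) ∪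
      (fun x => x + (-w j)) ⁻¹' bad (q a - q j) (v a - v j))
    have hne : ∀ j ∈ A, a ≠ j := fun j hj h => haA (h ▸ hj)
    have hB : volume B = 0 := by
      refine (measure_biUnion_null_iff hA.countable).2 fun j hj => measure_union_null ?_ ?_
      · rw [measure_preimage_add_right]
        exact bad_null _ _ (sub_ne_zero.2 fun h => hne j hj
          (hp (mem_insert _ _) (mem_insert_of_mem _ hj) h))
      · rw [measure_preimage_add_right]
        exact bad_null _ _ (sub_ne_zero.2 fun h => hne j hj
          (hq (mem_insert _ _) (mem_insert_of_mem _ hj) h))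
    have hex : ∃ x ∈ ball (0 : R2) η, x ∉ B := by
      by_contra h
      push Not at h
      have h1 := measure_mono_null h hB
      exact (measure_ball_pos volume (0 : R2) hη).ne' h1
    obtain ⟨x, hx, hxB⟩ := hex
    have hxj : ∀ j ∈ A, x - w j ∉ bad (p a - p j) (u a - u j) ∧ x - w j ∉ bad (q a - q j) (v a - v j) := by
      intro j hj
      constructor
      · intro h
        exact hxB (mem_biUnion hj (Or.inl (by simpa [sub_eq_add_neg] using h)))
      · intro h
        exact hxB (mem_biUnion hj (Or.inr (by simpa [sub_eq_add_neg] using h)))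
    classical
    refine ⟨Function.update w a x, ?_, ?_⟩
    · intro i
      by_cases h : i = a
      · subst h; simpa using hx
      · rw [Function.update_of_ne h]; exact hw1 i
    · intro i hi j hj hij
      rcases hi with rfl | hi <;> rcases hj with rfl | hj
      · exact (hij rfl).elim
      · rw [Function.update_self, Function.update_of_ne hij.symm]
        exact hxj j hj
      · rw [Function.update_self, Function.update_of_ne hij]
        have := hxj i hi
        rw [← neg_sub (p j), ← neg_sub (u j), ← neg_sub (q j), ← neg_sub (v j)]
        exact ⟨hsymm _ _ _ (by rw [neg_sub]; exact this.1), hsymm _ _ _ (by rw [neg_sub]; exact this.2)⟩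
      · rw [Function.update_of_ne (hne i hi).symm, Function.update_of_ne (hne j hj).symm]
        exact hw2 i hi j hj hij

lemma move (p : T2 → T2) (v : T2 → R2) (E : Set T2) (hE : E.Finite) (ε : ℝ) (hε : 0 < ε)
    (hv : ∀ i ∈ E, ‖v i‖ < ε) (hp : InjOn p E) (hq : InjOn (fun i => p i + pr (v i)) E) :
    ∃ g ∈ Homeo0Leb, (∀ i ∈ E, g (p i) = p i + pr (v i)) ∧ ∃ a < ε, ∀ y, dist (g y) y ≤ a := by
  have ha : ∀ᶠ a in 𝓝[<] ε, ∀ i ∈ E, ‖v i‖ < a := by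
    rw [hE.eventually_all]
    intro i hi
    filter_upwards [Ioo_mem_nhdsLT (hv i hi)] with a ha using ha.1
  obtain ⟨a, ha, ha0, haε⟩ := (ha.and (show ∀ᶠ a in 𝓝[<] ε, 0 < a ∧ a < ε from Ioo_mem_nhdsLT hε)).exists
  obtain ⟨η, hη⟩ : ∃ η : ℝ, η = (ε - a) / 4 := ⟨_, rfl⟩
  have hη0 : 0 < η := by rw [hη]; linarith
  obtain ⟨w, hw1, hw2⟩ := generic p (fun i => p i + pr (v i)) (fun i => (1/2 : ℝ) • v i)
    (fun i => -((1/2 : ℝ) • v i)) E hE η hη0 hp hq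
  have hhalf : ∀ i ∈ E, ‖(1/2 : ℝ) • v i‖ < a / 2 := by
    intro i hi
    have := ha i hi
    rw [norm_smul]; norm_num; linarith
  have conv : ∀ (p : T2 → T2) (u : T2 → R2) (i j : T2), w i - w j ∉ bad (p i - p j) (u i - u j) →
      ∀ t ∈ Icc (0:ℝ) 1, p i + pr (t • (u i + w i)) ≠ p j + pr (t • (u j + w j)) := by
    intro p u i j h t _ heq
    refine h ⟨t, ?_⟩
    rw [show u i - u j + (w i - w j) = (u i + w i) - (u j + w j) by abel, smul_sub, pr_sub,
      sub_add_sub_comm, heq, sub_self]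
  obtain ⟨g1, hg1, h11, h12⟩ := path p (fun i => (1/2 : ℝ) • v i + w i) E hE (a / 2 + η) (by positivity)
    (fun i hi => (norm_add_le _ _).trans_lt (add_lt_add (hhalf i hi) (hw1 i)))
    (fun i hi j hj hij => conv p (fun i => (1/2 : ℝ) • v i) i j (hw2 i hi j hj hij).1)
  obtain ⟨g2, hg2, h21, h22⟩ := path (fun i => p i + pr (v i)) (fun i => -((1/2 : ℝ) • v i) + w i) E hE
    (a / 2 + η) (by positivity)
    (fun i hi => (norm_add_le _ _).trans_lt (add_lt_add (by rw [norm_neg]; exact hhalf i hi) (hw1 i)))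
    (fun i hi j hj hij => conv (fun i => p i + pr (v i)) (fun i => -((1/2 : ℝ) • v i)) i j (hw2 i hi j hj hij).2)
  refine ⟨g1.trans g2.symm, Homeo0Leb_trans hg1 (Homeo0Leb_symm hg2), ?_, 2 * (a / 2 + η), ?_, ?_⟩
  · intro i hi
    rw [Homeomorph.trans_apply, Homeomorph.symm_apply_eq, h11 i hi, h21 i hi, add_assoc, ← pr_add]
    have e : v i + (-((1/2 : ℝ) • v i) + w i) = (1/2 : ℝ) • v i + w i := by module
    rw [e]
  · rw [hη]; linarith
  · intro y
    rw [Homeomorph.trans_apply]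
    have h1 := h12 y
    have h2 := h22 (g2.symm (g1 y))
    rw [Homeomorph.apply_symm_apply, dist_comm] at h2
    have := dist_triangle (g2.symm (g1 y)) (g1 y) y
    linarith

/-- $C⁰$ perturbation lemma: Let `E ⊂ T²` be finite, `σ : E → T²`
injective, `f ∈ Homeo_{0,λ}(T²)`, and `ε > 0`. If `d(f(x), σ(x)) < ε` for all
`x ∈ E`, then there is `g ∈ Homeo_{0,λ}(T²)` with `g = σ` on `E` and
`d_{C⁰}(f, g) < ε`. -/
theorem perturbation_lemma_leb (E : Set T2) (hE : E.Finite) (σ : T2 → T2)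
    (hσ : Set.InjOn σ E) (f : T2 ≃ₜ T2) (hf : f ∈ Homeo0Leb)
    (ε : ℝ) (hε : 0 < ε) (h : ∀ x ∈ E, dist (f x) (σ x) < ε) :
    ∃ g ∈ Homeo0Leb, (∀ x ∈ E, g x = σ x) ∧ dC0 f g < ε := by
  choose v hv using fun x : T2 => (fun h : dist (f x) (σ x) < ε =>
    exists_lift_lt (σ x - f x) ε (by rwa [dist_comm, dist_eq_norm] at h))
  classical
  let V : T2 → R2 := fun x => if h : dist (f x) (σ x) < ε then v x h else 0
  have hV : ∀ x ∈ E, pr (V x) = σ x - f x ∧ ‖V x‖ < ε := by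
    intro x hx
    simp only [V, dif_pos (h x hx)]
    exact hv x (h x hx)
  have hs : ∀ x ∈ E, f x + pr (V x) = σ x := by
    intro x hx
    rw [(hV x hx).1]; abel
  obtain ⟨g, hg, h1, a, ha, h2⟩ := move f V E hE ε hε (fun x hx => (hV x hx).2)
    f.injective.injOn (fun x hx y hy hxy => hσ hx hy (by
      simp only at hxy
      rwa [hs x hx, hs y hy] at hxy))
  refine ⟨f.trans g, Homeo0Leb_trans hf hg, ?_, ?_⟩
  · intro x hx
    rw [Homeomorph.trans_apply, h1 x hx, hs x hx]
  · refine lt_of_le_of_lt (ciSup_le fun x => ?_) ha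
    rw [Homeomorph.trans_apply, dist_comm]
    exact h2 (f x)
end
end

section
/- For every f ∈ Homeo₀(T²) and every lift f̃ of f, the pseudo-rotation set equals the rotation set: ρ_{p.o.}(f̃) = ⋂_{ε>0} ρ_ε(f̃) = ρ(f̃). -/
noncomputable section

open Metric Set Filter Topology MeasureTheory Pointwise

lemma exists_clog {A : Type*} [TopologicalSpace A] [SimplyConnectedSpace A]
    [LocallyPathConnectedSpace A] (a₀ : A) (g : A → ℂ) (hg : Continuous g) (h0 : ∀ x, g x ≠ 0) :
    ∃ L : A → ℂ, Continuous L ∧ ∀ x, Complex.exp (L x) = g x := by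
  obtain ⟨L, ⟨-, hL⟩, -⟩ := Complex.isCoveringMapOn_exp.existsUnique_continuousMap_lifts
    (⟨g, hg⟩ : C(A, ℂ)) (a₀ := a₀) (e₀ := Complex.log (g a₀)) (Complex.exp_log (h0 a₀))
    (fun a => h0 a)
  exact ⟨L, L.continuous, fun x => congrFun hL x⟩

lemma clog_const (h : ℝ → ℂ) (hh : Continuous h) (c : ℂ) (hc : ∀ t, Complex.exp (h t) = c)
    (s t : ℝ) : h s = h t := by
  have hc0 : c ≠ 0 := by rw [← hc 0]; exact Complex.exp_ne_zero _
  obtain ⟨L, -, hL⟩ := Complex.isCoveringMapOn_exp.existsUnique_continuousMap_lifts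
    (ContinuousMap.const ℝ c) (a₀ := s) (e₀ := h s) (hc s) (fun a => hc0)
  have h1 := hL ⟨h, hh⟩ ⟨rfl, funext hc⟩
  have h2 := hL (ContinuousMap.const ℝ (h s)) ⟨rfl, funext fun _ => hc s⟩
  have := congrArg (fun q : C(ℝ, ℂ) => q t) (h1.trans h2.symm)
  exact this.symm

lemma topo_key (γ : ℝ → ℂ) (hγ : Continuous γ) (m u : ℂ) (hm : γ 0 + γ 1 = 2 * m)
    (hu : ‖γ 0 + u - m‖ ≤ 1) (h1 : ∀ t, 1 < ‖γ t - m‖) (h2 : ∀ s t, γ t - γ s - u ≠ 0) : False := by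
  set e := γ 0 + u - m with he
  obtain ⟨L, hLc, hL⟩ := exists_clog ((0, 0) : ℝ × ℝ) (fun p : ℝ × ℝ => γ p.2 - γ p.1 - u)
    (by fun_prop) (fun p => h2 _ _)
  obtain ⟨M, hMc, hM⟩ := exists_clog ((0, 0) : ℝ × ℝ)
    (fun p : ℝ × ℝ => γ p.2 - m - (Real.sin p.1 : ℂ) * e) (by fun_prop) (by
      intro p hp
      have h3 : γ p.2 - m = (Real.sin p.1 : ℂ) * e := sub_eq_zero.mp hp
      have h4 := h1 p.2
      rw [h3, norm_mul, Complex.norm_real, Real.norm_eq_abs] at h4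
      have := Real.abs_sin_le_one p.1
      nlinarith [norm_nonneg e, abs_nonneg (Real.sin p.1)])
  have c1 := clog_const (fun s => L (s, s)) (by fun_prop) (-u) (fun t => by rw [hL]; simp) 0 1
  have c2 := clog_const (fun t => L (0, t) - M (Real.pi / 2, t)) (by fun_prop) 1 (fun t => by
    rw [Complex.exp_sub, hL, hM, div_eq_one_iff_eq]
    · simp [he]; ring
    · rw [← hM]; exact Complex.exp_ne_zero _) 0 1
  have c3 := clog_const (fun t => L (t, 1) - M (-(Real.pi / 2), t)) (by fun_prop) (-1) (fun t => by
    rw [Complex.exp_sub, hL, hM, div_eq_iff]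
    · simp [he]; linear_combination hm
    · rw [← hM]; exact Complex.exp_ne_zero _) 0 1
  have c4 := clog_const (fun τ => (M (τ, 1) + M (-τ, 1)) - (M (τ, 0) + M (-τ, 0)))
    (by fun_prop) 1 (fun τ => by
    rw [Complex.exp_sub, Complex.exp_add, Complex.exp_add, div_eq_one_iff_eq
      (mul_ne_zero (Complex.exp_ne_zero _) (Complex.exp_ne_zero _)), hM, hM, hM, hM]
    have : γ 1 = 2 * m - γ 0 := by linear_combination hm
    simp [this]; ring) 0 (Real.pi / 2)
  simp only [neg_zero] at c1 c2 c3 c4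
  have c5 : M (0, 1) = M (0, 0) := by linear_combination (c4 - c1 + c2 + c3) / 2
  have c6 := congrArg Complex.exp c5
  rw [hM, hM] at c6
  simp at c6
  have := h1 0
  have h7 : γ 0 - m = 0 := by linear_combination (hm - c6) / 2
  rw [h7] at this
  simp at this
  linarith

lemma infDist_segment (f : R2 → ℝ) (hf : Continuous f) (δ : ℝ)
    (h : ∀ p q, f ((1/2 : ℝ) • (p + q)) ≤ (f p + f q) / 2 + δ) (p q r : R2)
    (hr : r ∈ segment ℝ p q) : f r ≤ max (f p) (f q) + 2 * δ := by
  have hc : IsCompact ((fun t : ℝ => p + t • (q - p)) '' Icc (0:ℝ) 1) :=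
    isCompact_Icc.image (by fun_prop)
  rw [← segment_eq_image'] at hc
  obtain ⟨c, hcm, hmax⟩ := hc.exists_isMaxOn ⟨r, hr⟩ hf.continuousOn
  have hrc : f r ≤ f c := hmax hr
  refine hrc.trans ?_
  rw [segment_eq_image'] at hcm
  obtain ⟨t, ⟨ht0, ht1⟩, rfl⟩ := hcm
  rcases le_total t (1/2) with ht | ht
  · have hm : p + (2 * t) • (q - p) ∈ segment ℝ p q := by
      rw [segment_eq_image']; exact ⟨2 * t, ⟨by linarith, by linarith⟩, rfl⟩
    have h1 : f (p + (2 * t) • (q - p)) ≤ f (p + t • (q - p)) := hmax hm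
    have h2 := h p (p + (2 * t) • (q - p))
    have h3 : (1/2 : ℝ) • (p + (p + (2 * t) • (q - p))) = p + t • (q - p) := by module
    rw [h3] at h2
    have := le_max_left (f p) (f q)
    simp only at *
    linarith
  · have hm : p + (2 * t - 1) • (q - p) ∈ segment ℝ p q := by
      rw [segment_eq_image']; exact ⟨2 * t - 1, ⟨by linarith, by linarith⟩, rfl⟩
    have h1 : f (p + (2 * t - 1) • (q - p)) ≤ f (p + t • (q - p)) := hmax hm
    have h2 := h q (p + (2 * t - 1) • (q - p))
    have h3 : (1/2 : ℝ) • (q + (p + (2 * t - 1) • (q - p))) = p + t • (q - p) := by module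
    rw [h3] at h2
    have := le_max_right (f p) (f q)
    simp only at *
    linarith

lemma infDist_hull (K : Set R2) (δ : ℝ) (hδ : 0 ≤ δ)
    (h : ∀ p ∈ K, ∀ q ∈ K, ∃ r ∈ K, dist r ((1/2 : ℝ) • (p + q)) ≤ δ) (c : R2)
    (hc : c ∈ convexHull ℝ K) : infDist c K ≤ 6 * δ := by
  have hne : K.Nonempty := by
    rw [← convexHull_nonempty_iff (𝕜 := ℝ)]; exact ⟨c, hc⟩
  have hmid : ∀ p q, infDist ((1/2 : ℝ) • (p + q)) K ≤ (infDist p K + infDist q K) / 2 + δ := by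
    intro p q
    refine le_of_forall_pos_le_add fun η hη => ?_
    obtain ⟨a, ha, hpa⟩ := (infDist_lt_iff (r := infDist p K + η) hne).1 (by linarith)
    obtain ⟨b, hb, hqb⟩ := (infDist_lt_iff (r := infDist q K + η) hne).1 (by linarith)
    obtain ⟨r, hr, hrd⟩ := h a ha b hb
    refine (infDist_le_dist_of_mem hr).trans ?_
    rw [dist_eq_norm] at *
    have : (1/2 : ℝ) • (p + q) - r = (1/2 : ℝ) • (p - a) + (1/2 : ℝ) • (q - b)
      - (r - (1/2 : ℝ) • (a + b)) := by module
    rw [this]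
    have h1 := norm_sub_le ((1/2 : ℝ) • (p - a) + (1/2 : ℝ) • (q - b)) (r - (1/2 : ℝ) • (a + b))
    have h2 := norm_add_le ((1/2 : ℝ) • (p - a)) ((1/2 : ℝ) • (q - b))
    rw [norm_smul, norm_smul] at h2
    norm_num at h1 h2 hrd ⊢
    linarith
  have hfin : ∀ t : Finset R2, (t : Set R2) ⊆ K → ∀ x ∈ convexHull ℝ (t : Set R2),
      infDist x K ≤ 2 * δ * t.card := by
    intro t
    induction t using Finset.induction_on with
    | empty => intro _ x hx; simp at hx
    | insert a s has ih =>
      intro hs x hx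
      rw [Finset.coe_insert] at hs hx
      have haK : a ∈ K := hs (mem_insert _ _)
      rw [Finset.card_insert_of_notMem has]
      push_cast
      have hs0 : (0 : ℝ) ≤ s.card := by positivity
      rcases s.eq_empty_or_nonempty with rfl | hsne
      · simp at hx
        subst hx
        rw [infDist_zero_of_mem haK]; positivity
      · rw [convexHull_insert (by exact_mod_cast hsne)] at hx
        rw [mem_convexJoin] at hx
        obtain ⟨a', ha', b, hb, hxs⟩ := hx
        rw [mem_singleton_iff] at ha'
        subst ha'
        have hbd := ih ((subset_insert _ _).trans hs) b hb
        have := infDist_segment (fun z => infDist z K) (continuous_infDist_pt K) δ hmid _ _ _ hxs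
        simp only [infDist_zero_of_mem haK] at this
        have h3 : max 0 (infDist b K) ≤ 2 * δ * s.card := max_le (by positivity) hbd
        linarith
  rw [convexHull_eq_union] at hc
  simp only [mem_iUnion] at hc
  obtain ⟨t, ht, hai, hct⟩ := hc
  have h1 := hai.card_le_finrank_succ
  have h2 : Module.finrank ℝ (vectorSpan ℝ (Set.range ((↑) : t → R2))) ≤ 2 := by
    refine (Submodule.finrank_le _).trans ?_
    simp
  have h3 : t.card ≤ 3 := by
    rw [Fintype.card_coe] at h1; omega
  have h4 := hfin t ht c hct
  have h5 : (t.card : ℝ) ≤ 3 := by exact_mod_cast h3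
  nlinarith

lemma norm_le_of_coord (x : R2) (c : ℝ) (hc : 0 ≤ c) (h : ∀ i, |x i| ≤ c) : ‖x‖ ≤ 2 * c := by
  rw [EuclideanSpace.norm_eq, Fin.sum_univ_two]
  refine Real.sqrt_le_iff.2 ⟨by positivity, ?_⟩
  have h0 := h 0
  have h1 := h 1
  simp only [Real.norm_eq_abs]
  nlinarith [abs_nonneg (x 0), abs_nonneg (x 1)]

lemma fundDomain_norm {x : R2} (hx : x ∈ fundDomain) : ‖x‖ ≤ 2 := by
  have := norm_le_of_coord x 1 (by norm_num) (fun i => by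
    have := hx i
    rw [abs_le]; exact ⟨by linarith [this.1], this.2.le⟩)
  linarith

lemma exists_translate (x : R2) : ∃ w ∈ intLattice, x + w ∈ fundDomain := by
  refine ⟨WithLp.toLp 2 (fun i => -(⌊x i⌋ : ℝ)), fun i => ⟨-⌊x i⌋, by simp⟩, fun i => ?_⟩
  have h1 := Int.floor_le (x i)
  have h2 := Int.lt_floor_add_one (x i)
  simp only [PiLp.add_apply]
  constructor <;> linarith

lemma exists_near (x : R2) : ∃ w ∈ intLattice, ‖w - x‖ ≤ 1 := by
  refine ⟨WithLp.toLp 2 (fun i => (round (x i) : ℝ)), fun i => ⟨round (x i), by simp⟩, ?_⟩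
  have := norm_le_of_coord (WithLp.toLp 2 (fun i => (round (x i) : ℝ)) - x) (1/2) (by norm_num)
    (fun i => by
      have := abs_sub_round (x i)
      rw [abs_sub_comm] at this
      simpa using this)
  linarith

lemma midpoint_key (G : R2 → R2) (hG : Continuous G) (hi : Function.Injective G)
    (he : ∀ x, ∀ w ∈ intLattice, G (x + w) = G x + w) (x y : R2) (hx : x ∈ fundDomain)
    (hy : y ∈ fundDomain) : ∃ z ∈ fundDomain, ‖G z - (1/2 : ℝ) • (G x + G y)‖ ≤ 1 := by
  by_contra! hcon
  let T : R2 ≃ₗᵢ[ℝ] ℂ := Complex.orthonormalBasisOneI.repr.symm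
  let c : ℝ → ℝ := fun t => max 0 (min 1 t)
  have hc : Continuous c := by fun_prop
  have hc0 : ∀ t, 0 ≤ c t := fun t => le_max_left _ _
  have hc1 : ∀ t, c t ≤ 1 := fun t => max_le zero_le_one (min_le_left _ _)
  let p : ℝ → R2 := fun t => x + c t • (y - x)
  have hp : Continuous p := by fun_prop
  have hpD : ∀ t, p t ∈ fundDomain := by
    intro t i
    have h1 := hx i
    have h2 := hy i
    have h3 := hc0 t
    have h4 := hc1 t
    have h5 : p t i = (1 - c t) * x i + c t * y i := by simp [p]; ring
    rw [h5]
    exact (convex_Ico (0:ℝ) 1) h1 h2 (by linarith) h3 (by ring)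
  have hp0 : p 0 = x := by simp [p, c]
  have hp1 : p 1 = y := by simp [p, c]
  set m := (1/2 : ℝ) • (G x + G y) with hm
  obtain ⟨w, hw, hwn⟩ := exists_near ((1/2 : ℝ) • (G y - G x))
  have hTn : ∀ v, ‖T v‖ = ‖v‖ := fun v => T.norm_map v
  refine topo_key (fun t => T (G (p t))) (by fun_prop) (T m) (T w) ?_ ?_ ?_ ?_
  · simp only [hp0, hp1]
    have : T m + T m = T (G x) + T (G y) := by
      rw [← map_add, ← map_add]; congr 1; rw [hm]; module
    rw [two_mul, this]
  · simp only [hp0]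
    rw [← map_add, ← map_sub, hTn]
    have : G x + w - m = w - (1/2 : ℝ) • (G y - G x) := by rw [hm]; module
    rwa [this]
  · intro t
    rw [← map_sub, hTn]
    exact hcon _ (hpD t)
  · intro s t h
    rw [← map_sub, ← map_sub] at h
    have h1 : G (p t) - G (p s) - w = 0 :=
      (LinearIsometryEquiv.map_eq_zero_iff T).1 h
    have h2 : G (p t) = G (p s + w) := by
      rw [he _ _ hw, ← sub_eq_zero, ← h1]; abel
    have h3 := hi h2
    have hw0 : w = 0 := by
      ext i
      obtain ⟨n, hn⟩ := hw i
      have h4 : p t i = p s i + w i := by rw [h3]; simp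
      have h5 := hpD t i
      have h6 := hpD s i
      have h7 : (n : ℝ) < 1 := by rw [← hn]; linarith [h5.2, h6.1]
      have h8 : (-1 : ℝ) < n := by rw [← hn]; linarith [h6.2, h5.1]
      have h9 : n < 1 := by exact_mod_cast h7
      have h10 : -1 < n := by exact_mod_cast h8
      have : n = 0 := by omega
      rw [hn, this]; simp
    rw [hw0] at hwn
    have h4 := hcon x hx
    have h5 : G x - m = 0 - (1/2 : ℝ) • (G y - G x) := by rw [hm]; module
    rw [h5] at h4
    linarith

lemma iter_equiv (F : R2 → R2) (he : ∀ x, ∀ w ∈ intLattice, F (x + w) = F x + w) (n : ℕ) :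
    ∀ x, ∀ w ∈ intLattice, F^[n] (x + w) = F^[n] x + w := by
  induction n with
  | zero => intro x w _; rfl
  | succ n ih =>
    intro x w hw
    rw [Function.iterate_succ_apply', Function.iterate_succ_apply', ih x w hw, he _ _ hw]

lemma KN_mid (F : R2 → R2) (hc : Continuous F) (hi : Function.Injective F)
    (he : ∀ x, ∀ w ∈ intLattice, F (x + w) = F x + w) (N : ℕ) (hN : 0 < N) :
    let K := Set.range fun x => (N : ℝ)⁻¹ • (F^[N] x - x)
    ∀ p ∈ K, ∀ q ∈ K, ∃ r ∈ K, dist r ((1/2 : ℝ) • (p + q)) ≤ 5 / N := by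
  intro K p hp q hq
  have key : ∀ p ∈ K, ∃ x ∈ fundDomain, p = (N : ℝ)⁻¹ • (F^[N] x - x) := by
    rintro _ ⟨x, rfl⟩
    obtain ⟨w, hw, hx⟩ := exists_translate x
    refine ⟨x + w, hx, ?_⟩
    simp only
    rw [iter_equiv F he N x w hw]
    congr 1
    abel
  obtain ⟨x, hx, rfl⟩ := key p hp
  obtain ⟨y, hy, rfl⟩ := key q hq
  obtain ⟨z, hz, hzn⟩ := midpoint_key (F^[N]) (hc.iterate N) (hi.iterate N) (iter_equiv F he N)
    x y hx hy
  refine ⟨_, ⟨z, rfl⟩, ?_⟩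
  have hN' : (0 : ℝ) < N := by exact_mod_cast hN
  rw [dist_eq_norm]
  have : (N : ℝ)⁻¹ • (F^[N] z - z) - (1/2 : ℝ) • ((N : ℝ)⁻¹ • (F^[N] x - x) +
      (N : ℝ)⁻¹ • (F^[N] y - y)) = (N : ℝ)⁻¹ • ((F^[N] z - (1/2 : ℝ) • (F^[N] x + F^[N] y))
        - (z - (1/2 : ℝ) • (x + y))) := by module
  simp only
  rw [this, norm_smul, norm_inv, Real.norm_natCast, inv_mul_eq_div]
  gcongr
  have h1 := norm_sub_le (F^[N] z - (1/2 : ℝ) • (F^[N] x + F^[N] y)) (z - (1/2 : ℝ) • (x + y))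
  have h2 := norm_sub_le z ((1/2 : ℝ) • (x + y))
  have h3 := norm_add_le x y
  have h4 : ‖(1/2 : ℝ) • (x + y)‖ = 1/2 * ‖x + y‖ := by rw [norm_smul]; norm_num
  have := fundDomain_norm hx
  have := fundDomain_norm hy
  have := fundDomain_norm hz
  linarith

lemma lift_unif (F : R2 → R2) (hc : Continuous F)
    (he : ∀ x, ∀ w ∈ intLattice, F (x + w) = F x + w) (η : ℝ) (hη : 0 < η) :
    ∃ δ > 0, ∀ x y, dist x y < δ → dist (F x) (F y) < η := by
  have h1 := (isCompact_closedBall (0 : R2) 3).uniformContinuousOn_of_continuous hc.continuousOn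
  rw [Metric.uniformContinuousOn_iff] at h1
  obtain ⟨δ, hδ, h⟩ := h1 η hη
  refine ⟨min δ 1, by positivity, fun x y hxy => ?_⟩
  obtain ⟨w, hw, hx⟩ := exists_translate x
  have hxn := fundDomain_norm hx
  have hd : dist (x + w) (y + w) = dist x y := dist_add_right _ _ _
  have hyn : ‖y + w‖ ≤ 3 := by
    have h2 := norm_sub_norm_le (y + w) (x + w)
    rw [← dist_eq_norm, dist_comm, hd] at h2
    linarith [hxy.trans_le (min_le_right δ 1)]
  have := h (x + w) (by simpa using by linarith) (y + w) (by simpa using hyn)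
    (by rw [hd]; exact hxy.trans_le (min_le_left _ _))
  rwa [he _ _ hw, he _ _ hw, dist_add_right] at this

lemma lift_bdd (F : R2 → R2) (hc : Continuous F)
    (he : ∀ x, ∀ w ∈ intLattice, F (x + w) = F x + w) :
    ∃ B ≥ 0, ∀ x, ‖F x - x‖ ≤ B := by
  obtain ⟨B, hB⟩ := (isCompact_closedBall (0 : R2) 3).exists_bound_of_continuousOn
    (f := fun x => F x - x) (by fun_prop)
  refine ⟨max B 0, le_max_right _ _, fun x => ?_⟩
  obtain ⟨w, hw, hx⟩ := exists_translate x
  have hxn := fundDomain_norm hx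
  have := hB (x + w) (by simpa using by linarith)
  simp only [he _ _ hw, add_sub_add_right_eq_sub] at this
  exact this.trans (le_max_left _ _)

lemma shadow (F : R2 → R2) (hc : Continuous F)
    (he : ∀ x, ∀ w ∈ intLattice, F (x + w) = F x + w) (N : ℕ) :
    ∀ η > 0, ∃ ε > 0, ∀ x : ℕ → R2, IsPseudoOrbitUpTo F ε x N → dist (F^[N] (x 0)) (x N) < η := by
  induction N with
  | zero => intro η hη; exact ⟨1, one_pos, fun x _ => by simpa using hη⟩
  | succ N ih =>
    intro η hη
    obtain ⟨δ, hδ, hu⟩ := lift_unif F hc he (η / 2) (by positivity)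
    obtain ⟨ε, hε, h⟩ := ih δ hδ
    refine ⟨min ε (η / 2), by positivity, fun x hx => ?_⟩
    have h1 := h x (fun i hi => (hx i (by omega)).trans_le (min_le_left _ _))
    have h2 := hu _ _ h1
    have h3 := (hx N (by omega)).trans_le (min_le_right _ _)
    rw [Function.iterate_succ_apply']
    linarith [dist_triangle (F (F^[N] (x 0))) (F (x N)) (x (N + 1))]

lemma hull_close (F : R2 → R2) (hc : Continuous F)
    (he : ∀ x, ∀ w ∈ intLattice, F (x + w) = F x + w) (N : ℕ) (hN : 0 < N) (v : R2)
    (hv : v ∈ ⋂ ε ∈ Set.Ioi (0 : ℝ), pseudoRotSet F ε) :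
    ∃ c ∈ convexHull ℝ (Set.range fun x => (N : ℝ)⁻¹ • (F^[N] x - x)), ‖v - c‖ ≤ 3 / N := by
  set K := Set.range fun x => (N : ℝ)⁻¹ • (F^[N] x - x) with hK
  have hN' : (0 : ℝ) < N := by exact_mod_cast hN
  obtain ⟨B, hB0, hB⟩ := lift_bdd F hc he
  obtain ⟨B', hB'0, hB'⟩ := lift_bdd (F^[N]) (hc.iterate N) (iter_equiv F he N)
  obtain ⟨ε, hε, hsh⟩ := shadow F hc he N 1 one_pos
  simp only [mem_iInter] at hv
  obtain ⟨n, x, hn, hx, hlim⟩ := hv (min ε 1) (by simp [hε])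
  -- the constant controlling the errors
  set C : ℝ := N * (B + 1) + B' with hC
  have hC0 : 0 ≤ C := by positivity
  have hlim2 : Tendsto (fun k => C / (n k : ℝ)) atTop (𝓝 0) :=
    Tendsto.div_atTop tendsto_const_nhds (tendsto_natCast_atTop_atTop.comp hn)
  have e1 : ∀ᶠ k in atTop, C / (n k : ℝ) < 1 / N := hlim2.eventually_lt_const (by positivity)
  have e2 : ∀ᶠ k in atTop, dist ((n k : ℝ)⁻¹ • (x k (n k) - x k 0)) v < 1 / N :=
    (Metric.tendsto_nhds.1 hlim) _ (by positivity)
  obtain ⟨k, h1, h2, h3⟩ := (e1.and (e2.and (hn.eventually_ge_atTop N))).exists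
  have hxk := hx k
  generalize x k = y at *
  generalize n k = M at *
  have hM' : (0 : ℝ) < M := by exact_mod_cast (lt_of_lt_of_le hN h3)
  set q := M / N with hq
  have hq1 : 1 ≤ q := (Nat.one_le_div_iff hN).2 h3
  have hq' : (0 : ℝ) < q := by exact_mod_cast hq1
  have hMq : N * q + M % N = M := Nat.div_add_mod M N
  have hmod : M % N < N := Nat.mod_lt _ hN
  have hqM : (N : ℝ) * q ≤ M := by exact_mod_cast (by omega : N * q ≤ M)
  have hqM2 : (M : ℝ) - N * q ≤ N := by
    have : (M : ℝ) ≤ N * q + N := by exact_mod_cast (by omega : M ≤ N * q + N)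
    linarith
  set φ : R2 → R2 := fun x => (N : ℝ)⁻¹ • (F^[N] x - x) with hφ
  let c : R2 := ∑ j ∈ Finset.range q, (q : ℝ)⁻¹ • φ (y (N * j))
  have hcK : c ∈ convexHull ℝ K := by
    refine (convex_convexHull ℝ K).sum_mem (fun _ _ => by positivity) ?_ ?_
    · simp; field_simp
    · intro j _; exact subset_convexHull ℝ K ⟨_, rfl⟩
  have hφn : ∀ z, ‖φ z‖ ≤ B' / N := by
    intro z
    rw [hφ]
    simp only
    rw [norm_smul, norm_inv, Real.norm_natCast, inv_mul_eq_div]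
    gcongr
    exact hB' z
  have hcn : ‖c‖ ≤ B' / N := by
    refine (norm_sum_le_of_le (s := Finset.range q) (n := fun _ => (q : ℝ)⁻¹ * (B' / N)) ?_).trans ?_
    · intro j _
      rw [norm_smul, norm_inv, Real.norm_natCast]
      gcongr
      exact hφn _
    · simp; field_simp; exact le_rfl
  -- blocks
  have hblock : ∀ j ∈ Finset.range q, ‖(y (N * (j + 1)) - y (N * j)) - (N : ℝ) • φ (y (N * j))‖ ≤ 1 := by
    intro j hj
    have hj' : j + 1 ≤ q := Finset.mem_range.1 hj
    have hle : N * (j + 1) ≤ M := (Nat.mul_le_mul_left N hj').trans (by omega)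
    have := hsh (fun i => y (N * j + i)) (fun i hi =>
      (hxk (N * j + i) (by rw [mul_add] at hle; omega)).trans_le (min_le_left _ _))
    rw [dist_comm, dist_eq_norm] at this
    have h5 : (N : ℝ) • φ (y (N * j)) = F^[N] (y (N * j)) - y (N * j) := by
      simp only [hφ]; rw [smul_smul, mul_inv_cancel₀ hN'.ne', one_smul]
    rw [h5, mul_add, mul_one]
    refine le_trans (le_of_eq ?_) this.le
    congr 1
    simp
  have hsum : ‖(y (N * q) - y 0) - ((N : ℝ) * q) • c‖ ≤ q := by
    have h6 : (y (N * q) - y 0) - ((N : ℝ) * q) • c =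
        ∑ j ∈ Finset.range q, ((y (N * (j + 1)) - y (N * j)) - (N : ℝ) • φ (y (N * j))) := by
      rw [Finset.sum_sub_distrib, Finset.sum_range_sub (fun j => y (N * j))]
      simp only [c, Finset.smul_sum, smul_smul]
      simp only [mul_zero]
      congr 1
      refine Finset.sum_congr rfl fun j _ => ?_
      congr 1
      field_simp
    rw [h6]
    refine (norm_sum_le_of_le _ hblock).trans ?_
    simp
  have htail : ∀ r, N * q + r ≤ M → ‖y (N * q + r) - y (N * q)‖ ≤ r * (B + 1) := by
    intro r
    induction r with
    | zero => intro _; simp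
    | succ r ih =>
      intro hr
      have h7 := ih (by omega)
      have h8 := (hxk (N * q + r) (by omega)).trans_le (min_le_right _ _)
      rw [dist_comm, dist_eq_norm] at h8
      have h9 := hB (y (N * q + r))
      have : y (N * q + (r + 1)) - y (N * q) = (y (N * q + r + 1) - F (y (N * q + r))) +
        (F (y (N * q + r)) - y (N * q + r)) + (y (N * q + r) - y (N * q)) := by
        rw [← add_assoc]; abel
      rw [this]
      refine (norm_add₃_le).trans ?_
      push_cast
      linarith
  have ht := htail (M % N) hMq.le
  rw [hMq] at ht
  have ht2 : ‖y M - y (N * q)‖ ≤ N * (B + 1) := by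
    refine ht.trans ?_
    have : ((M % N : ℕ) : ℝ) ≤ N := by exact_mod_cast hmod.le
    gcongr
  have htot : ‖(y M - y 0) - (M : ℝ) • c‖ ≤ q + C := by
    have h10 : (y M - y 0) - (M : ℝ) • c = ((y (N * q) - y 0) - ((N : ℝ) * q) • c) +
      (y M - y (N * q)) + (-((M : ℝ) - N * q)) • c := by module
    rw [h10]
    refine (norm_add₃_le).trans ?_
    have h11 : ‖(-((M : ℝ) - N * q)) • c‖ ≤ B' := by
      rw [norm_smul, norm_neg, Real.norm_of_nonneg (by linarith)]
      calc ((M : ℝ) - N * q) * ‖c‖ ≤ N * (B' / N) := by gcongr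
        _ = B' := by field_simp
    rw [hC]
    linarith
  refine ⟨c, hcK, ?_⟩
  have h12 : ‖(M : ℝ)⁻¹ • (y M - y 0) - c‖ ≤ 1 / N + C / M := by
    have h13 : (M : ℝ)⁻¹ • (y M - y 0) - c = (M : ℝ)⁻¹ • ((y M - y 0) - (M : ℝ) • c) := by
      rw [smul_sub _ (y M - y 0), smul_smul, inv_mul_cancel₀ hM'.ne', one_smul]
    rw [h13, norm_smul, norm_inv, Real.norm_natCast, inv_mul_eq_div]
    calc _ ≤ (q + C) / M := by gcongr
      _ = q / M + C / M := by ring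
      _ ≤ 1 / N + C / M := by
        gcongr ?_ + _
        rw [div_le_div_iff₀ hM' hN']
        linarith
  rw [dist_eq_norm] at h2
  have h14 : v - c = ((M : ℝ)⁻¹ • (y M - y 0) - c) - ((M : ℝ)⁻¹ • (y M - y 0) - v) := by abel
  rw [h14]
  refine (norm_sub_le _ _).trans ?_
  have : (3 : ℝ) / N = 1 / N + 1 / N + 1 / N := by ring
  linarith

/-- For every `f ∈ Homeo₀(T²)` and every lift `F` of `f`, the
pseudo-rotation set equals the rotation set: `⋂_{ε>0} ρ_ε(F) = ρ(F)`. -/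
theorem pseudoRotSet_inter_eq_rotSet (f : T2 ≃ₜ T2) (hf : f ∈ Homeo0)
    (F : R2 ≃ₜ R2) (hF : IsLift f F) :
    ⋂ ε ∈ Set.Ioi (0 : ℝ), pseudoRotSet (⇑F) ε = rotSet F := by
  apply Set.Subset.antisymm
  · intro v hv
    have key : ∀ N : ℕ, ∃ z, ‖((N + 1 : ℕ) : ℝ)⁻¹ • ((⇑F)^[N + 1] z - z) - v‖ ≤
        34 / ((N + 1 : ℕ) : ℝ) := by
      intro N
      have hN' : (0 : ℝ) < ((N + 1 : ℕ) : ℝ) := by positivity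
      obtain ⟨c, hc, hvc⟩ := hull_close F F.continuous hF.equivariant (N + 1) (by omega) v hv
      have h1 := infDist_hull _ (5 / ((N + 1 : ℕ) : ℝ)) (by positivity)
        (KN_mid F F.continuous F.injective hF.equivariant (N + 1) (by omega)) c hc
      have h2 : 6 * (5 / ((N + 1 : ℕ) : ℝ)) < 31 / ((N + 1 : ℕ) : ℝ) := by
        rw [← mul_div_assoc]; gcongr; norm_num
      obtain ⟨_, ⟨z, rfl⟩, hz⟩ := (infDist_lt_iff (Set.range_nonempty _)).1 (h1.trans_lt h2)
      refine ⟨z, ?_⟩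
      rw [dist_eq_norm] at hz
      simp only at hz
      have h3 : ((N + 1 : ℕ) : ℝ)⁻¹ • ((⇑F)^[N + 1] z - z) - v =
        -(v - c) - (c - ((N + 1 : ℕ) : ℝ)⁻¹ • ((⇑F)^[N + 1] z - z)) := by abel
      rw [h3]
      refine (norm_sub_le _ _).trans ?_
      rw [norm_neg]
      have : (34 : ℝ) / ((N + 1 : ℕ) : ℝ) = 3 / ((N + 1 : ℕ) : ℝ) + 31 / ((N + 1 : ℕ) : ℝ) := by ring
      linarith
    choose z hz using key
    refine ⟨z, fun k => k + 1, tendsto_add_atTop_nat 1, ?_⟩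
    rw [tendsto_iff_norm_sub_tendsto_zero]
    refine squeeze_zero (fun _ => norm_nonneg _) hz ?_
    exact Tendsto.div_atTop tendsto_const_nhds
      (tendsto_natCast_atTop_atTop.comp (tendsto_add_atTop_nat 1))
  · rintro v ⟨z, n, hn, hlim⟩
    simp only [mem_iInter]
    intro ε hε
    refine ⟨n, fun k i => (⇑F)^[i] (z k), hn, fun k i _ => ?_, hlim⟩
    simp only [Function.iterate_succ_apply', dist_self]
    exact hε
end
end
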